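/- arXiv:1403.4918 — 11 statements merged into one kernel-verified Lean document; each statement's English description precedes it below -/
import Mathlib

section
/- A residuated lattice A has the Boolean Lifting Property if and only if for every a ∈ A there exists e ∈ B(A) such that d(a,e) ∈ [a ∨ ¬a). -/
/-- A (commutative integral bounded) residuated lattice: a bounded lattice together
with a commutative monoid structure (whose unit is the top element) and a residuum
operation satisfying the law of residuation. -/
class ResiduatedLattice (A : Type*) extends Lattice A, BoundedOrder A, CommMonoid A where
  rimp : A → A → A
  residuation : ∀ a b c : A, a ≤ rimp b c ↔ a * b ≤ c
  one_eq_top : (1 : A) = ⊤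

namespace ResiduatedLattice

variable {A : Type*} [ResiduatedLattice A]

/-- Negation: ¬a = a → 0. -/
def rneg (a : A) : A := rimp a ⊥

/-- Biresiduum: d(a,b) = (a → b) ∧ (b → a). -/
def bires (a b : A) : A := rimp a b ⊓ rimp b a

/-- Membership in the Boolean center B(A): complemented elements of the bounded lattice. -/
def IsBoolElem (e : A) : Prop := ∃ f : A, e ⊔ f = ⊤ ∧ e ⊓ f = ⊥

/-- A filter of a residuated lattice. -/
def IsRLFilter (F : Set A) : Prop :=
  F.Nonempty ∧ (∀ a b : A, a ∈ F → b ∈ F → a * b ∈ F) ∧ (∀ a b : A, a ∈ F → a ≤ b → b ∈ F)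

/-- The principal filter [x) = {a | xⁿ ≤ a for some n ≥ 1}. -/
def princ (x : A) : Set A := {a : A | ∃ n : ℕ, 1 ≤ n ∧ x ^ n ≤ a}

/-- A filter F has the Boolean Lifting Property. -/
def HasBLP (F : Set A) : Prop :=
  ∀ a : A, a ⊔ rneg a ∈ F → ∃ e : A, IsBoolElem e ∧ bires a e ∈ F

/-- A filter F has the Idempotent Lifting Property. -/
def HasILP (F : Set A) : Prop :=
  ∀ a : A, bires a (a * a) ∈ F → ∃ e : A, e * e = e ∧ bires a e ∈ F

end ResiduatedLattice

open ResiduatedLattice in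
theorem stmt_0 {A : Type*} [ResiduatedLattice A] :
    (∀ F : Set A, IsRLFilter F → HasBLP F) ↔
      (∀ a : A, ∃ e : A, IsBoolElem e ∧ bires a e ∈ princ (a ⊔ rneg a)) := by
  have mono : ∀ a b c d : A, a ≤ b → c ≤ d → a * c ≤ b * d := by
    have h1 : ∀ a b c : A, a ≤ b → a * c ≤ b * c := fun a b c h =>
      (residuation a c (b * c)).1 (h.trans ((residuation b c (b * c)).2 le_rfl))
    intro a b c d h h'
    refine (h1 a b c h).trans ?_
    rw [mul_comm b c, mul_comm b d]
    exact h1 c d b h'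
  constructor
  · intro H a
    refine H (princ (a ⊔ rneg a)) ⟨⟨a ⊔ rneg a, 1, le_rfl, by rw [pow_one]⟩, ?_, ?_⟩ a
      ⟨1, le_rfl, by rw [pow_one]⟩
    · rintro x y ⟨n, hn, hx⟩ ⟨m, hm, hy⟩
      refine ⟨n + m, by omega, ?_⟩
      rw [pow_add]
      exact mono _ _ _ _ hx hy
    · rintro x y ⟨n, hn, hx⟩ hxy
      exact ⟨n, hn, hx.trans hxy⟩
  · rintro H F ⟨-, hmul, hup⟩ a ha
    obtain ⟨e, he, n, hn, hle⟩ := H a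
    refine ⟨e, he, hup _ _ ?_ hle⟩
    clear hle
    induction n, hn using Nat.le_induction with
    | base => rwa [pow_one]
    | succ k hk ih =>
      rw [pow_succ]
      exact hmul _ _ ih ha
end

section
/- A residuated lattice A has the Idempotent Lifting Property if and only if for every a ∈ A there exists e ∈ A with e ⊙ e = e such that d(a,e) ∈ [d(a, a ⊙ a)). -/
namespace ResiduatedLattice

variable {A : Type*} [ResiduatedLattice A]

/-- A proper filter. -/
def IsProperRLFilter (F : Set A) : Prop := IsRLFilter F ∧ F ≠ Set.univ

/-- A maximal filter: a proper filter maximal under inclusion among proper filters. -/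
def IsMaxRLFilter (M : Set A) : Prop :=
  IsProperRLFilter M ∧ ∀ G : Set A, IsProperRLFilter G → M ⊆ G → G = M

/-- A prime filter: a proper filter P with a ∨ b ∈ P → a ∈ P or b ∈ P. -/
def IsPrimeRLFilter (P : Set A) : Prop :=
  IsProperRLFilter P ∧ ∀ a b : A, a ⊔ b ∈ P → a ∈ P ∨ b ∈ P

/-- The radical: intersection of all maximal filters. -/
def rad (A : Type*) [ResiduatedLattice A] : Set A :=
  {a : A | ∀ M : Set A, IsMaxRLFilter M → a ∈ M}

/-- v(a) = set of maximal filters containing a. -/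
def vset (a : A) : Set (Set A) := {M : Set A | IsMaxRLFilter M ∧ a ∈ M}

/-- d(a) = set of maximal filters not containing a. -/
def dset (a : A) : Set (Set A) := {M : Set A | IsMaxRLFilter M ∧ a ∉ M}

/-- An element is nilpotent iff some positive power of it is 0. -/
def RLNilpotent (a : A) : Prop := ∃ n : ℕ, 1 ≤ n ∧ a ^ n = ⊥

/-- The join F ∨ G of two filters: the smallest filter including F ∪ G. -/
def filtJoin (F G : Set A) : Set A := ⋂₀ {H : Set A | IsRLFilter H ∧ F ∪ G ⊆ H}

end ResiduatedLattice

namespace ResiduatedLattice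

theorem aux_mul_le_mul {A : Type*} [ResiduatedLattice A] {a b c d : A}
    (h₁ : a ≤ b) (h₂ : c ≤ d) : a * c ≤ b * d := by
  have key : ∀ x y z : A, x ≤ y → x * z ≤ y * z := fun x y z h =>
    (residuation x z (y * z)).1 (h.trans ((residuation y z (y * z)).2 le_rfl))
  calc a * c ≤ b * c := key _ _ _ h₁
    _ = c * b := mul_comm _ _
    _ ≤ d * b := key _ _ _ h₂
    _ = b * d := mul_comm _ _

theorem aux_princ_filter {A : Type*} [ResiduatedLattice A] (x : A) :
    IsRLFilter (princ x) := by
  refine ⟨⟨x, 1, le_rfl, by simp⟩, ?_, ?_⟩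
  · rintro a b ⟨n, hn, ha⟩ ⟨m, hm, hb⟩
    exact ⟨n + m, by omega, by rw [pow_add]; exact aux_mul_le_mul ha hb⟩
  · rintro a b ⟨n, hn, ha⟩ hab
    exact ⟨n, hn, ha.trans hab⟩

theorem aux_pow_mem {A : Type*} [ResiduatedLattice A] {F : Set A} (hF : IsRLFilter F)
    {x : A} (hx : x ∈ F) (n : ℕ) (hn : 1 ≤ n) : x ^ n ∈ F := by
  induction n, hn using Nat.le_induction with
  | base => simpa using hx
  | succ k _ ih => rw [pow_succ]; exact hF.2.1 _ _ ih hx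

end ResiduatedLattice

open ResiduatedLattice in
theorem stmt_1 {A : Type*} [ResiduatedLattice A] :
    (∀ F : Set A, IsRLFilter F → HasILP F) ↔
      (∀ a : A, ∃ e : A, e * e = e ∧ bires a e ∈ princ (bires a (a * a))) := by
  constructor
  · intro h a
    exact h _ (aux_princ_filter _) a ⟨1, le_rfl, by simp⟩
  · intro h F hF a ha
    obtain ⟨e, he, n, hn, hle⟩ := h a
    exact ⟨e, he, hF.2.2 _ _ (aux_pow_mem hF ha n hn) hle⟩
end

section
/- Let A be a residuated lattice and F a filter of A such that for every a ∈ A there exists e ∈ B(A) with d(a,e) ∈ F. Then every filter G of A with F ⊆ G has both the Boolean Lifting Property and the Idempotent Lifting Property. -/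
open ResiduatedLattice in
theorem stmt_3 {A : Type*} [ResiduatedLattice A] (F : Set A) (hF : IsRLFilter F)
    (h : ∀ a : A, ∃ e : A, IsBoolElem e ∧ bires a e ∈ F) :
    ∀ G : Set A, IsRLFilter G → F ⊆ G → HasBLP G ∧ HasILP G := by
  intro G _ hFG
  have mul_le : ∀ x y : A, x * y ≤ y := fun x y => by
    rw [← residuation]
    refine le_trans le_top ?_
    rw [← one_eq_top, residuation, one_mul]
  have idem : ∀ e : A, IsBoolElem e → e * e = e := by
    rintro e ⟨f, h1, h2⟩
    refine le_antisymm (mul_le e e) ?_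
    have hk : e ⊔ f ≤ rimp e (e * e) := by
      refine sup_le ((residuation _ _ _).2 le_rfl) ((residuation _ _ _).2 ?_)
      refine le_trans (le_inf (mul_le f e) ?_) (h2.le.trans bot_le)
      rw [mul_comm]
      exact mul_le e f
    rw [h1, ← one_eq_top, residuation, one_mul] at hk
    exact hk
  constructor
  · intro a _
    obtain ⟨e, he, hd⟩ := h a
    exact ⟨e, he, hFG hd⟩
  · intro a _
    obtain ⟨e, he, hd⟩ := h a
    exact ⟨e, idem e he, hFG hd⟩
end

section
/- A residuated lattice A has the Boolean Lifting Property if and only if for every natural number n ≥ 2 and all x₁,…,xₙ ∈ A with x₁ ⊙ … ⊙ xₙ = 0, there exist e₁,…,eₙ ∈ B(A) such that e₁ ∧ … ∧ eₙ = 0, eᵢ ∨ eⱼ = 1 for all i ≠ j, and eᵢ ∈ [xᵢ) for all i. -/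
namespace ResiduatedLattice

section Helpers
variable {A : Type*} [ResiduatedLattice A]

theorem hp_le_one (a : A) : a ≤ 1 := by rw [one_eq_top]; exact le_top

theorem hp_mul_right {a b : A} (c : A) (h : a ≤ b) : a * c ≤ b * c :=
  (residuation a c (b * c)).1 (h.trans ((residuation b c (b * c)).2 le_rfl))

theorem hp_mul_mono {a b c d : A} (h : a ≤ b) (k : c ≤ d) : a * c ≤ b * d := by
  refine (hp_mul_right c h).trans ?_
  rw [mul_comm b c, mul_comm b d]
  exact hp_mul_right b k

theorem hp_mul_left_le (a b : A) : a * b ≤ a := by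
  simpa using hp_mul_mono (le_refl a) (hp_le_one b)

theorem hp_mul_right_le (a b : A) : a * b ≤ b := by
  rw [mul_comm]; exact hp_mul_left_le b a

theorem hp_sup_mul_le {a b c d : A} (h : a * c ≤ d) (k : b * c ≤ d) : (a ⊔ b) * c ≤ d :=
  (residuation _ _ _).1 (sup_le ((residuation _ _ _).2 h) ((residuation _ _ _).2 k))

theorem hp_mul_sup_le {a b c d : A} (h : c * a ≤ d) (k : c * b ≤ d) : c * (a ⊔ b) ≤ d := by
  rw [mul_comm] at *
  exact hp_sup_mul_le h k

theorem hp_pow_mono {a b : A} (h : a ≤ b) (n : ℕ) : a ^ n ≤ b ^ n := by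
  induction n with
  | zero => simp
  | succ n ih => rw [pow_succ, pow_succ]; exact hp_mul_mono ih h

theorem hp_sup_pow (a b : A) (n : ℕ) : (a ⊔ b) ^ n ≤ a ⊔ b ^ n := by
  induction n with
  | zero => simp
  | succ n ih =>
    rw [pow_succ, pow_succ]
    refine (hp_mul_right _ ih).trans (hp_sup_mul_le ?_ (hp_mul_sup_le ?_ ?_))
    · exact (hp_mul_left_le _ _).trans le_sup_left
    · exact (hp_mul_right_le _ _).trans le_sup_left
    · exact le_sup_right

theorem hp_mul_bot {e f : A} (h : e ⊓ f = ⊥) : e * f ≤ ⊥ := by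
  rw [← h]; exact le_inf (hp_mul_left_le _ _) (hp_mul_right_le _ _)

/-- case split along a pair with join one -/
theorem hp_split {e f z d : A} (h : e ⊔ f = ⊤) (h1 : z * e ≤ d) (h2 : z * f ≤ d) : z ≤ d := by
  have := hp_mul_sup_le h1 h2
  rwa [h, ← one_eq_top, mul_one] at this

theorem hp_le_mul {e f z : A} (h : e ⊔ f = ⊤) (h' : e ⊓ f = ⊥) (hz : z ≤ e) : z ≤ z * e :=
  hp_split h le_rfl (((hp_mul_right f hz).trans (hp_mul_bot h')).trans bot_le)

theorem hp_sup_mul_cancel {e f a : A} (h' : e ⊓ f = ⊥) : (a ⊔ f) * e ≤ a :=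
  hp_sup_mul_le (hp_mul_left_le _ _)
    ((by rw [mul_comm]; exact hp_mul_bot h' : f * e ≤ ⊥).trans bot_le)

theorem hp_bool_sup {a b : A} (ha : IsBoolElem a) (hb : IsBoolElem b) : IsBoolElem (a ⊔ b) := by
  obtain ⟨a', h1, h2⟩ := ha
  obtain ⟨b', k1, k2⟩ := hb
  refine ⟨a' ⊓ b', top_le_iff.1 ?_, le_bot_iff.1 ?_⟩
  · refine hp_split h1 ?_ (hp_split k1 ?_ ?_)
    · exact (hp_mul_right_le _ _).trans (le_sup_left.trans le_sup_left)
    · exact (hp_mul_right_le _ _).trans (le_sup_right.trans le_sup_left)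
    · exact le_sup_of_le_right (le_inf ((hp_mul_left_le _ _).trans (hp_mul_right_le _ _))
        (hp_mul_right_le _ _))
  · set z := (a ⊔ b) ⊓ (a' ⊓ b') with hz
    have z1 : z ≤ a ⊔ b := inf_le_left
    have z2 : z ≤ a' := inf_le_right.trans inf_le_left
    have z3 : z ≤ b' := inf_le_right.trans inf_le_right
    have e1 : z ≤ a := (hp_le_mul (by rwa [sup_comm]) (by rwa [inf_comm]) z3).trans
      ((hp_mul_right _ z1).trans (hp_sup_mul_cancel (by rwa [inf_comm])))
    rw [← h2]
    exact le_inf e1 z2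

theorem hp_princ_filter (x : A) : IsRLFilter (princ x) := by
  refine ⟨⟨x, 1, le_rfl, by simp⟩, ?_, ?_⟩
  · rintro a b ⟨n, hn, ha⟩ ⟨m, hm, hb⟩
    exact ⟨n + m, by omega, by rw [pow_add]; exact hp_mul_mono ha hb⟩
  · rintro a b ⟨n, hn, ha⟩ h
    exact ⟨n, hn, ha.trans h⟩

theorem hp_filter_pow {F : Set A} (hF : IsRLFilter F) {a : A} (ha : a ∈ F) (n : ℕ) :
    a ^ n ∈ F := by
  induction n with
  | zero => rw [pow_zero]; exact hF.2.2 a 1 ha (hp_le_one a)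
  | succ n ih => rw [pow_succ]; exact hF.2.1 _ _ ih ha

theorem hp_filter_inf {F : Set A} (hF : IsRLFilter F) {a b : A} (ha : a ∈ F) (hb : b ∈ F) :
    a ⊓ b ∈ F :=
  hF.2.2 _ _ (hF.2.1 _ _ ha hb) (le_inf (hp_mul_left_le _ _) (hp_mul_right_le _ _))

theorem hp_two (H : ∀ F : Set A, IsRLFilter F → HasBLP F) {x y : A} (h : x * y = ⊥) :
    ∃ e f : A, e ⊔ f = ⊤ ∧ e ⊓ f = ⊥ ∧ e ∈ princ x ∧ f ∈ princ y := by
  have hy : y ≤ rneg x := (residuation _ _ _).2 (by rw [mul_comm, h])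
  obtain ⟨e, ⟨f, h1, h2⟩, k, hk, hd⟩ := H (princ (x ⊔ y)) (hp_princ_filter _) x
    ⟨1, le_rfl, by rw [pow_one]; exact sup_le_sup_left hy x⟩
  have d1 := (residuation _ _ _).1 (hd.trans inf_le_left)
  have d2 := (residuation _ _ _).1 (hd.trans inf_le_right)
  refine ⟨e, f, h1, h2, ⟨k + 1, by omega, ?_⟩, ⟨k + 1, by omega, ?_⟩⟩
  · rw [pow_succ]
    exact (hp_mul_right x (hp_pow_mono le_sup_left k)).trans d1
  · refine hp_split h1 ?_ (hp_mul_right_le _ _)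
    have := hp_mul_right y ((hp_mul_right e (hp_pow_mono le_sup_right k)).trans d2)
    rw [h] at this
    rw [pow_succ, mul_right_comm]
    exact this.trans bot_le

theorem hp_many (H : ∀ F : Set A, IsRLFilter F → HasBLP F) (n : ℕ) (hn : 1 ≤ n) :
    ∀ x : Fin n → A, (∏ i, x i) = ⊥ →
        ∃ e : Fin n → A, (∀ i, IsBoolElem (e i)) ∧
          (Finset.univ.inf e = ⊥) ∧
          (∀ i j, i ≠ j → e i ⊔ e j = ⊤) ∧
          (∀ i, e i ∈ princ (x i)) := by
  induction n, hn using Nat.le_induction with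
  | base =>
    intro x hx
    refine ⟨fun _ => ⊥, fun _ => ⟨⊤, by simp, by simp⟩, by simp, ?_, ?_⟩
    · intro i j hij
      exact absurd (Subsingleton.elim i j) hij
    · intro i
      refine ⟨1, le_rfl, ?_⟩
      rw [Fin.prod_univ_one] at hx
      rw [Subsingleton.elim i 0, hx, pow_one]
  | succ n hn ih =>
    intro x hx
    rw [Fin.prod_univ_succ] at hx
    obtain ⟨e, f, h1, h2, he, k, hk, hf⟩ := hp_two H hx
    obtain ⟨g, gB, gI, gJ, gP⟩ := ih (fun i => x i.succ ^ k * e) (by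
      rw [Finset.prod_mul_distrib, Finset.prod_pow, Finset.prod_const, Finset.card_univ,
        Fintype.card_fin]
      obtain ⟨m, rfl⟩ : ∃ m, n = m + 1 := ⟨n - 1, by omega⟩
      refine le_bot_iff.1 ((hp_mul_mono hf (d := e) ?_).trans ?_)
      · rw [pow_succ]; exact hp_mul_right_le _ _
      · rw [mul_comm]; exact hp_mul_bot h2)
    refine ⟨Fin.cons e (fun i => g i ⊔ f), ?_, ?_, ?_, ?_⟩
    · intro i
      refine Fin.cases ?_ (fun i => ?_) i
      · exact ⟨f, h1, h2⟩
      · exact hp_bool_sup (gB i) ⟨e, by rwa [sup_comm], by rwa [inf_comm]⟩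
    · refine le_bot_iff.1 ?_
      set z := Finset.univ.inf (Fin.cons e (fun i => g i ⊔ f) : Fin (n + 1) → A) with hz
      have z0 : z ≤ e := Finset.inf_le (f := (Fin.cons e (fun i => g i ⊔ f) : Fin (n + 1) → A))
        (Finset.mem_univ 0)
      rw [← gI]
      refine Finset.le_inf fun i _ => ?_
      have zi : z ≤ g i ⊔ f :=
        Finset.inf_le (f := (Fin.cons e (fun i => g i ⊔ f) : Fin (n + 1) → A))
          (Finset.mem_univ i.succ)
      exact (hp_le_mul h1 h2 z0).trans ((hp_mul_right _ zi).trans (hp_sup_mul_cancel h2))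
    · intro i j
      refine Fin.cases ?_ (fun i => ?_) i <;> refine Fin.cases ?_ (fun j => ?_) j
      · intro h; exact absurd rfl h
      · intro _
        simp only [Fin.cons_zero, Fin.cons_succ]
        rw [sup_left_comm, h1, sup_top_eq]
      · intro _
        simp only [Fin.cons_zero, Fin.cons_succ]
        rw [sup_assoc, sup_comm f e, h1, sup_top_eq]
      · intro h
        simp only [Fin.cons_succ]
        refine top_le_iff.1 ?_
        rw [← gJ i j (fun hh => h (by rw [hh]))]
        exact sup_le_sup le_sup_left le_sup_left
    · intro i
      refine Fin.cases ?_ (fun i => ?_) i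
      · exact he
      · obtain ⟨m, hm, hg⟩ := gP i
        refine ⟨k * m, Nat.mul_pos hk hm, ?_⟩
        simp only [Fin.cons_succ]
        have p : (1 : A) ≤ f ⊔ e ^ m := by
          have := hp_sup_pow f e m
          rwa [sup_comm f e, h1, ← one_eq_top, one_pow] at this
        calc x i.succ ^ (k * m) = x i.succ ^ (k * m) * 1 := (mul_one _).symm
          _ ≤ x i.succ ^ (k * m) * (f ⊔ e ^ m) := hp_mul_mono le_rfl p
          _ ≤ g i ⊔ f := by
            refine hp_mul_sup_le ((hp_mul_right_le _ _).trans le_sup_right) ?_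
            rw [pow_mul, ← mul_pow]
            exact hg.trans le_sup_left

theorem hp_conv {F : Set A} (hF : IsRLFilter F) {a e f : A} (ha : a ⊔ rneg a ∈ F)
    (h2 : e ⊓ f = ⊥) (he : e ∈ princ a) (hf : f ∈ princ (rneg a)) : bires a e ∈ F := by
  obtain ⟨k, hk, he⟩ := he
  obtain ⟨m, hm, hf⟩ := hf
  have n0 : rneg a * a ≤ ⊥ := (residuation _ _ _).1 le_rfl
  refine hp_filter_inf hF (hF.2.2 _ _ (hp_filter_pow hF ha k) ((residuation _ _ _).2 ?_))
    (hF.2.2 _ _ (hp_filter_pow hF ha m) ((residuation _ _ _).2 ?_))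
  · rw [sup_comm]
    refine (hp_mul_right a (hp_sup_pow _ _ k)).trans (hp_sup_mul_le (n0.trans bot_le) ?_)
    exact (hp_mul_left_le _ _).trans he
  · refine (hp_mul_right e (hp_sup_pow _ _ m)).trans (hp_sup_mul_le (hp_mul_left_le _ _) ?_)
    refine (hp_mul_right e hf).trans ?_
    rw [mul_comm]
    exact (hp_mul_bot h2).trans bot_le

end Helpers

end ResiduatedLattice

open ResiduatedLattice in
theorem stmt_5 {A : Type*} [ResiduatedLattice A] :
    (∀ F : Set A, IsRLFilter F → HasBLP F) ↔
      (∀ n : ℕ, 2 ≤ n → ∀ x : Fin n → A, (∏ i, x i) = ⊥ →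
        ∃ e : Fin n → A, (∀ i, IsBoolElem (e i)) ∧
          (Finset.univ.inf e = ⊥) ∧
          (∀ i j, i ≠ j → e i ⊔ e j = ⊤) ∧
          (∀ i, e i ∈ princ (x i))) := by
  constructor
  · intro H n hn x hx
    exact hp_many H n (by omega) x hx
  · intro H F hF a ha
    obtain ⟨e, eB, eI, eJ, eP⟩ := H 2 le_rfl ![a, rneg a] (by
      rw [Fin.prod_univ_two]
      refine le_bot_iff.1 ?_
      rw [mul_comm]
      exact (residuation _ _ _).1 le_rfl)
    refine ⟨e 0, eB 0, hp_conv (f := e 1) hF ha ?_ (eP 0) (eP 1)⟩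
    rw [← le_bot_iff, ← eI]
    refine Finset.le_inf fun i _ => ?_
    fin_cases i
    · exact inf_le_left
    · exact inf_le_right
end

section
/- If A is a linearly ordered residuated lattice and a ∈ A satisfies a ⊙ a = a, then the principal filter [a) has the Idempotent Lifting Property. -/
open ResiduatedLattice in
theorem stmt_6 {A : Type*} [ResiduatedLattice A]
    (htotal : ∀ a b : A, a ≤ b ∨ b ≤ a) (a : A) (ha : a * a = a) :
    HasILP (princ a) := by
  have mono : ∀ x y z : A, x ≤ y → x * z ≤ y * z := by
    intro x y z h
    exact (residuation _ _ _).1 (h.trans ((residuation _ _ _).2 le_rfl))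
  have mle : ∀ x y : A, x * y ≤ y := by
    intro x y
    have h := mono x 1 y (by rw [one_eq_top]; exact le_top)
    rwa [one_mul] at h
  have hpow : ∀ n : ℕ, a ≤ a ^ (n + 1) := by
    intro n
    induction n with
    | zero => simp
    | succ k ih =>
      have h := mono _ _ a ih
      rw [ha] at h
      rwa [pow_succ]
  intro x hx
  obtain ⟨n, hn, hx⟩ := hx
  obtain ⟨k, rfl⟩ : ∃ k, n = k + 1 := ⟨n - 1, by omega⟩
  have h1 : a * x ≤ x * x :=
    (residuation _ _ _).1 (((hpow k).trans hx).trans inf_le_left)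
  have h2 : (a * x) * (a * x) = (x * x) * a := by
    rw [mul_mul_mul_comm, ha, mul_comm]
  refine ⟨a * x, ?_, 1, le_rfl, ?_⟩
  · rw [h2]
    apply le_antisymm
    · have h := mono (x * x) x a (mle x x)
      rwa [mul_comm x a] at h
    · have h := mono _ _ a h1
      rwa [mul_comm (a * x) a, ← mul_assoc, ha] at h
  · rw [pow_one]
    refine le_inf ((residuation _ _ _).2 le_rfl) ((residuation _ _ _).2 ?_)
    exact (mle _ _).trans (mle _ _)
end

section
/- If A is a residuated lattice whose underlying order is a well-order (every nonempty subset of A has a least element), then A has the Idempotent Lifting Property, i.e., every filter of A has ILP. -/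
open ResiduatedLattice in
theorem stmt_7 {A : Type*} [ResiduatedLattice A]
    (hwo : ∀ S : Set A, S.Nonempty → ∃ m ∈ S, ∀ x ∈ S, m ≤ x) :
    ∀ F : Set A, IsRLFilter F → HasILP F := by
  intro F hF a ha
  obtain ⟨hne, hmul, hup⟩ := hF
  obtain ⟨f, hfF, hf⟩ := hwo F hne
  have mono : ∀ x y z : A, x ≤ y → x * z ≤ y * z := fun x y z h =>
    (residuation x z (y * z)).1 (h.trans ((residuation y z (y * z)).2 le_rfl))
  have mulle : ∀ x y : A, x * y ≤ y := fun x y => by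
    have h := mono x 1 y (by rw [one_eq_top]; exact le_top)
    rwa [one_mul] at h
  have hff : f * f = f := le_antisymm (mulle f f) (hf _ (hmul f f hfF hfF))
  have hfa : f * a ≤ a * a :=
    (residuation f a (a * a)).1 ((hf _ ha).trans inf_le_left)
  have e1 : (f * a) * (f * a) = f * (a * a) := by
    rw [mul_mul_mul_comm, hff]
  refine ⟨f * a, ?_, ?_⟩
  · apply le_antisymm (mulle _ _)
    rw [e1]
    have h := mono _ _ f hfa
    rw [mul_comm _ f, mul_comm _ f, ← mul_assoc, hff] at h
    exact h
  · refine hup f _ hfF (le_inf ?_ ?_)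
    · exact (residuation _ _ _).2 le_rfl
    · exact (residuation _ _ _).2 ((mulle _ _).trans (mulle _ _))
end

section
/- Let A be a residuated lattice, a ∈ A and e ∈ B(A). Then: (1) v(a) ⊆ v(e) if and only if a ⊙ ¬e is nilpotent; (2) v(a) ⊆ d(e) if and only if a ⊙ e is nilpotent; (3) d(a) ⊆ v(e) if and only if a ∨ e ∈ Rad(A). -/
namespace ResiduatedLattice

theorem h_mul_mono {A : Type*} [ResiduatedLattice A] {a b : A} (c : A) (h : a ≤ b) :
    a * c ≤ b * c :=
  (residuation a c (b * c)).1 (h.trans ((residuation b c (b * c)).2 le_rfl))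

theorem h_mul_mono2 {A : Type*} [ResiduatedLattice A] {a b c d : A} (h : a ≤ b) (h' : c ≤ d) :
    a * c ≤ b * d := by
  refine (h_mul_mono c h).trans ?_
  rw [mul_comm b c, mul_comm b d]
  exact h_mul_mono b h'

theorem h_mul_le_left {A : Type*} [ResiduatedLattice A] (a b : A) : a * b ≤ a := by
  have := h_mul_mono2 (le_refl a) (le_top : b ≤ ⊤)
  rwa [← one_eq_top, mul_one] at this

theorem h_mul_le_right {A : Type*} [ResiduatedLattice A] (a b : A) : a * b ≤ b := by
  rw [mul_comm]; exact h_mul_le_left b a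

theorem h_sup_mul_le {A : Type*} [ResiduatedLattice A] {a b c d : A} (h : a * c ≤ d)
    (h' : b * c ≤ d) : (a ⊔ b) * c ≤ d :=
  (residuation _ _ _).1 (sup_le ((residuation _ _ _).2 h) ((residuation _ _ _).2 h'))

theorem h_idem {A : Type*} [ResiduatedLattice A] {e : A} (he : IsBoolElem e) : e * e = e := by
  obtain ⟨f, h1, h2⟩ := he
  apply le_antisymm (h_mul_le_left e e)
  have h3 : (e ⊔ f) * e ≤ e * e := by
    apply h_sup_mul_le le_rfl
    have : f * e ≤ e ⊓ f := le_inf (h_mul_le_right f e) (h_mul_le_left f e)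
    rw [h2] at this
    exact this.trans bot_le
  rwa [h1, ← one_eq_top, one_mul] at h3

theorem h_top_mem {A : Type*} [ResiduatedLattice A] {F : Set A} (h : IsRLFilter F) :
    (1 : A) ∈ F := by
  obtain ⟨x, hx⟩ := h.1
  exact h.2.2 x 1 hx (one_eq_top (A := A) ▸ le_top)

theorem h_pow_mem {A : Type*} [ResiduatedLattice A] {F : Set A} (h : IsRLFilter F) {x : A}
    (hx : x ∈ F) (n : ℕ) : x ^ n ∈ F := by
  induction n with
  | zero => rw [pow_zero]; exact h_top_mem h
  | succ k ih => rw [pow_succ]; exact h.2.1 _ _ ih hx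

theorem h_bot_notMem {A : Type*} [ResiduatedLattice A] {F : Set A} (h : IsProperRLFilter F) :
    (⊥ : A) ∉ F := fun hb =>
  h.2 (Set.eq_univ_of_forall fun x => h.1.2.2 ⊥ x hb bot_le)

theorem h_not_nil {A : Type*} [ResiduatedLattice A] {F : Set A} (h : IsProperRLFilter F) {x : A}
    (hx : x ∈ F) : ¬ RLNilpotent x := by
  rintro ⟨n, -, hn⟩
  exact h_bot_notMem h (hn ▸ h_pow_mem h.1 hx n)

theorem h_exists_max {A : Type*} [ResiduatedLattice A] {x : A} (hx : ¬ RLNilpotent x) :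
    ∃ M : Set A, IsMaxRLFilter M ∧ x ∈ M := by
  have hp : IsProperRLFilter (princ x) := by
    refine ⟨⟨⟨x, 1, le_rfl, by simp⟩, ?_, ?_⟩, ?_⟩
    · rintro a b ⟨n, hn, h⟩ ⟨m, _, h'⟩
      exact ⟨n + m, by omega, by rw [pow_add]; exact h_mul_mono2 h h'⟩
    · rintro a b ⟨n, hn, h⟩ h'
      exact ⟨n, hn, h.trans h'⟩
    · intro h
      have : (⊥ : A) ∈ princ x := h ▸ Set.mem_univ _
      obtain ⟨n, hn, h'⟩ := this
      exact hx ⟨n, hn, le_bot_iff.1 h'⟩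
  obtain ⟨M, hM, hmax⟩ := zorn_subset_nonempty {F : Set A | IsProperRLFilter F} (by
    intro c hc hch hne
    refine ⟨⋃₀ c, ⟨⟨?_, ?_, ?_⟩, ?_⟩, fun s hs => Set.subset_sUnion_of_mem hs⟩
    · obtain ⟨F, hF⟩ := hne
      exact ⟨1, F, hF, h_top_mem (hc hF).1⟩
    · rintro a b ⟨F, hF, ha⟩ ⟨G, hG, hb⟩
      rcases hch.total hF hG with h | h
      · exact ⟨G, hG, (hc hG).1.2.1 _ _ (h ha) hb⟩
      · exact ⟨F, hF, (hc hF).1.2.1 _ _ ha (h hb)⟩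
    · rintro a b ⟨F, hF, ha⟩ hab
      exact ⟨F, hF, (hc hF).1.2.2 _ _ ha hab⟩
    · intro h
      have : (⊥ : A) ∈ ⋃₀ c := h ▸ Set.mem_univ _
      obtain ⟨F, hF, hb⟩ := this
      exact h_bot_notMem (hc hF) hb) (princ x) hp
  refine ⟨M, ⟨hmax.1, fun G hG h => Set.Subset.antisymm (hmax.2 hG h) h⟩, hM ?_⟩
  exact ⟨1, le_rfl, by simp⟩

theorem h_compl {A : Type*} [ResiduatedLattice A] {M : Set A} (hM : IsMaxRLFilter M) {e : A}
    (he : e * e = e) (h : e ∉ M) : ∃ m ∈ M, m * e = ⊥ := by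
  by_contra hc
  push Not at hc
  have h1 := h_top_mem hM.1.1
  have hG : IsProperRLFilter {z : A | ∃ m ∈ M, m * e ≤ z} := by
    refine ⟨⟨⟨e, 1, h1, by simp⟩, ?_, ?_⟩, ?_⟩
    · rintro a b ⟨m, hm, h⟩ ⟨k, hk, h'⟩
      refine ⟨m * k, hM.1.1.2.1 _ _ hm hk, ?_⟩
      have := h_mul_mono2 h h'
      rwa [mul_mul_mul_comm, he] at this
    · rintro a b ⟨m, hm, h⟩ h'
      exact ⟨m, hm, h.trans h'⟩
    · intro h
      have : (⊥ : A) ∈ {z : A | ∃ m ∈ M, m * e ≤ z} := h ▸ Set.mem_univ _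
      obtain ⟨m, hm, h'⟩ := this
      exact hc m hm (le_bot_iff.1 h')
  have := hM.2 _ hG (fun m hm => ⟨m, hm, h_mul_le_left m e⟩)
  apply h
  rw [← this]
  exact ⟨1, h1, by simp⟩

end ResiduatedLattice

open ResiduatedLattice in
theorem stmt_9 {A : Type*} [ResiduatedLattice A] (a e : A) (he : IsBoolElem e) :
    (vset a ⊆ vset e ↔ RLNilpotent (a * rneg e)) ∧
    (vset a ⊆ dset e ↔ RLNilpotent (a * e)) ∧
    (dset a ⊆ vset e ↔ a ⊔ e ∈ rad A) := by
  have hi := h_idem he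
  refine ⟨⟨fun h => ?_, ?_⟩, ⟨fun h => ?_, ?_⟩, ⟨?_, ?_⟩⟩
  · by_contra hn
    obtain ⟨M, hM, hx⟩ := h_exists_max hn
    have h2 := (h ⟨hM, hM.1.1.2.2 _ _ hx (h_mul_le_left _ _)⟩).2
    have h3 := hM.1.1.2.2 _ _ hx (h_mul_le_right _ _)
    exact h_bot_notMem hM.1 (hM.1.1.2.2 _ _ (hM.1.1.2.1 _ _ h3 h2)
      ((residuation _ _ _).1 (le_refl (rneg e))))
  · rintro hn M ⟨hM, ha⟩
    refine ⟨hM, ?_⟩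
    by_contra h
    obtain ⟨m, hm, h'⟩ := h_compl hM hi h
    have h3 : rneg e ∈ M := hM.1.1.2.2 _ _ hm ((residuation _ _ _).2 h'.le)
    exact h_not_nil hM.1 (hM.1.1.2.1 _ _ ha h3) hn
  · by_contra hn
    obtain ⟨M, hM, hx⟩ := h_exists_max hn
    exact (h ⟨hM, hM.1.1.2.2 _ _ hx (h_mul_le_left _ _)⟩).2
      (hM.1.1.2.2 _ _ hx (h_mul_le_right _ _))
  · rintro hn M ⟨hM, ha⟩
    exact ⟨hM, fun h => h_not_nil hM.1 (hM.1.1.2.1 _ _ ha h) hn⟩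
  · intro h M hM
    by_cases ha : a ∈ M
    · exact hM.1.1.2.2 _ _ ha le_sup_left
    · exact hM.1.1.2.2 _ _ (h ⟨hM, ha⟩).2 le_sup_right
  · rintro h M ⟨hM, ha⟩
    refine ⟨hM, ?_⟩
    by_contra h'
    obtain ⟨m, hm, hme⟩ := h_compl hM hi h'
    exact ha (hM.1.1.2.2 _ _ (hM.1.1.2.1 _ _ (h M hM) hm)
      (h_sup_mul_le (h_mul_le_left a m) (by rw [mul_comm, hme]; exact bot_le)))
end

section
/- For a residuated lattice A, the following are equivalent: (1) for all filters F, G of A with F ∨ G = A there exist filters U, V of A such that U ∩ V = {1} and U ∨ F = V ∨ G = A; (2) for all x, y ∈ A with [x) ∨ [y) = A there exist u, v ∈ A such that [u) ∩ [v) = {1} and [u) ∨ [x) = [v) ∨ [y) = A. -/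
namespace ResiduatedLattice

section helpers

variable {B : Type*} [ResiduatedLattice B]

theorem aux_le_one (a : B) : a ≤ 1 := by
  rw [one_eq_top]; exact le_top

theorem aux_mul_right {a b : B} (h : a ≤ b) (c : B) : a * c ≤ b * c :=
  (residuation a c (b * c)).1 (h.trans ((residuation b c (b * c)).2 le_rfl))

theorem aux_mul {a b c d : B} (h : a ≤ b) (h' : c ≤ d) : a * c ≤ b * d := by
  refine (aux_mul_right h c).trans ?_
  rw [mul_comm b c, mul_comm b d]
  exact aux_mul_right h' b

theorem aux_one_mem {F : Set B} (hF : IsRLFilter F) : (1 : B) ∈ F := by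
  obtain ⟨a, ha⟩ := hF.1
  exact hF.2.2 a 1 ha (aux_le_one a)

theorem aux_self_mem (x : B) : x ∈ princ x := ⟨1, le_rfl, by simp⟩

theorem aux_princ (x : B) : IsRLFilter (princ x) := by
  refine ⟨⟨x, aux_self_mem x⟩, ?_, ?_⟩
  · rintro a b ⟨n, hn, ha⟩ ⟨m, hm, hb⟩
    exact ⟨n + m, by omega, by rw [pow_add]; exact aux_mul ha hb⟩
  · rintro a b ⟨n, hn, ha⟩ hab
    exact ⟨n, hn, ha.trans hab⟩

theorem aux_princ_sub {x : B} {F : Set B} (hF : IsRLFilter F) (hx : x ∈ F) : princ x ⊆ F := by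
  rintro a ⟨n, -, ha⟩
  refine hF.2.2 _ _ ?_ ha
  clear ha
  induction n with
  | zero => simpa using aux_one_mem hF
  | succ k ih => rw [pow_succ]; exact hF.2.1 _ _ ih hx

theorem aux_join {F G : Set B} (hF : IsRLFilter F) (hG : IsRLFilter G) :
    filtJoin F G = Set.univ ↔ ∃ f ∈ F, ∃ g ∈ G, f * g = ⊥ := by
  constructor
  · intro h
    have hb : (⊥ : B) ∈ filtJoin F G := by rw [h]; trivial
    have := hb {a | ∃ f ∈ F, ∃ g ∈ G, f * g ≤ a} ⟨⟨?_, ?_, ?_⟩, ?_⟩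
    · obtain ⟨f, hf, g, hg, h⟩ := this
      exact ⟨f, hf, g, hg, le_bot_iff.1 h⟩
    · exact ⟨1, 1, aux_one_mem hF, 1, aux_one_mem hG, by simp⟩
    · rintro a b ⟨f, hf, g, hg, h⟩ ⟨f', hf', g', hg', h'⟩
      exact ⟨f * f', hF.2.1 _ _ hf hf', g * g', hG.2.1 _ _ hg hg', by
        rw [mul_mul_mul_comm]; exact aux_mul h h'⟩
    · rintro a b ⟨f, hf, g, hg, h⟩ hab
      exact ⟨f, hf, g, hg, h.trans hab⟩
    · rintro a (ha | ha)
      · exact ⟨a, ha, 1, aux_one_mem hG, by simp⟩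
      · exact ⟨1, aux_one_mem hF, a, ha, by simp⟩
  · rintro ⟨f, hf, g, hg, h⟩
    refine Set.eq_univ_of_forall fun a H hH => ?_
    have := hH.1.2.1 f g (hH.2 (Or.inl hf)) (hH.2 (Or.inr hg))
    rw [h] at this
    exact hH.1.2.2 _ _ this bot_le

end helpers

end ResiduatedLattice

open ResiduatedLattice in
theorem stmt_15 {A : Type*} [ResiduatedLattice A] :
    (∀ F G : Set A, IsRLFilter F → IsRLFilter G → filtJoin F G = Set.univ →
        ∃ U V : Set A, IsRLFilter U ∧ IsRLFilter V ∧ U ∩ V = {(1 : A)} ∧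
          filtJoin U F = Set.univ ∧ filtJoin V G = Set.univ) ↔
      (∀ x y : A, filtJoin (princ x) (princ y) = Set.univ →
        ∃ u v : A, princ u ∩ princ v = {(1 : A)} ∧
          filtJoin (princ u) (princ x) = Set.univ ∧
          filtJoin (princ v) (princ y) = Set.univ) := by
  constructor
  · intro H x y hxy
    obtain ⟨U, V, hU, hV, hUV, h1, h2⟩ := H _ _ (aux_princ x) (aux_princ y) hxy
    obtain ⟨u, hu, f, hf, huf⟩ := (aux_join hU (aux_princ x)).1 h1
    obtain ⟨v, hv, g, hg, hvg⟩ := (aux_join hV (aux_princ y)).1 h2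
    refine ⟨u, v, ?_, ?_, ?_⟩
    · apply Set.Subset.antisymm
      · rw [← hUV]
        exact Set.inter_subset_inter (aux_princ_sub hU hu) (aux_princ_sub hV hv)
      · rintro a rfl
        exact ⟨aux_one_mem (aux_princ u), aux_one_mem (aux_princ v)⟩
    · exact (aux_join (aux_princ u) (aux_princ x)).2 ⟨u, aux_self_mem u, f, hf, huf⟩
    · exact (aux_join (aux_princ v) (aux_princ y)).2 ⟨v, aux_self_mem v, g, hg, hvg⟩
  · intro H F G hF hG hFG
    obtain ⟨x, hx, y, hy, hxy⟩ := (aux_join hF hG).1 hFG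
    obtain ⟨u, v, huv, h1, h2⟩ := H x y
      ((aux_join (aux_princ x) (aux_princ y)).2 ⟨x, aux_self_mem x, y, aux_self_mem y, hxy⟩)
    obtain ⟨a, ha, f, hf, haf⟩ := (aux_join (aux_princ u) (aux_princ x)).1 h1
    obtain ⟨b, hb, g, hg, hbg⟩ := (aux_join (aux_princ v) (aux_princ y)).1 h2
    exact ⟨princ u, princ v, aux_princ u, aux_princ v, huv,
      (aux_join (aux_princ u) hF).2 ⟨a, ha, f, aux_princ_sub hF hx hf, haf⟩,
      (aux_join (aux_princ v) hG).2 ⟨b, hb, g, aux_princ_sub hG hy hg, hbg⟩⟩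
end

section
/- Let L be a conormal bounded distributive lattice and R = Rad(L) its radical. Then R has the Boolean Lifting Property: for every x ∈ L such that there exist y ∈ L and a ∈ R with x ∨ y ≡ 1 (mod R) and x ∧ y ≡ 0 (mod R), there exists a complemented element e of L with e ≡ x (mod R). -/
namespace BddDistLat

variable {L : Type*} [DistribLattice L] [BoundedOrder L]

/-- A filter of a bounded distributive lattice. -/
def IsLatFilter (F : Set L) : Prop :=
  F.Nonempty ∧ (∀ x y : L, x ∈ F → y ∈ F → x ⊓ y ∈ F) ∧ (∀ x y : L, x ∈ F → x ≤ y → y ∈ F)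

/-- A maximal filter: a proper filter maximal under inclusion among proper filters. -/
def IsMaxLatFilter (M : Set L) : Prop :=
  (IsLatFilter M ∧ M ≠ Set.univ) ∧
    ∀ G : Set L, (IsLatFilter G ∧ G ≠ Set.univ) → M ⊆ G → G = M

/-- The radical: intersection of all maximal filters. -/
def latRad (L : Type*) [DistribLattice L] [BoundedOrder L] : Set L :=
  {x : L | ∀ M : Set L, IsMaxLatFilter M → x ∈ M}

/-- Congruence modulo a filter R: x ≡ y (mod R) iff x ∧ a = y ∧ a for some a ∈ R. -/
def congMod (R : Set L) (x y : L) : Prop := ∃ a ∈ R, x ⊓ a = y ⊓ a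

/-- A bounded distributive lattice is conormal iff whenever x ∧ y = 0 there are u, v
with u ∨ v = 1 and u ∧ x = v ∧ y = 0. -/
def Conormal (L : Type*) [DistribLattice L] [BoundedOrder L] : Prop :=
  ∀ x y : L, x ⊓ y = ⊥ → ∃ u v : L, u ⊔ v = ⊤ ∧ u ⊓ x = ⊥ ∧ v ⊓ y = ⊥

end BddDistLat

namespace BddDistLat

theorem ne_univ_iff_aux {L : Type*} [DistribLattice L] [BoundedOrder L] {F : Set L}
    (hF : IsLatFilter F) : F ≠ Set.univ ↔ ⊥ ∉ F := by
  constructor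
  · intro h hb
    exact h (Set.eq_univ_of_forall fun z => hF.2.2 ⊥ z hb bot_le)
  · intro h he
    exact h (he ▸ Set.mem_univ _)

theorem exists_max_aux {L : Type*} [DistribLattice L] [BoundedOrder L] {b : L} (hb : b ≠ ⊥) :
    ∃ M : Set L, IsMaxLatFilter M ∧ b ∈ M := by
  have hI : IsLatFilter (Set.Ici b) :=
    ⟨⟨b, le_refl b⟩, fun x y hx hy => le_inf hx hy, fun x y hx hxy => le_trans hx hxy⟩
  obtain ⟨M, hbM, hM⟩ := zorn_subset_nonempty {F : Set L | IsLatFilter F ∧ ⊥ ∉ F} (by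
    intro c hc hchain hne
    refine ⟨⋃₀ c, ⟨⟨?_, ?_, ?_⟩, ?_⟩, fun s hs => Set.subset_sUnion_of_mem hs⟩
    · obtain ⟨F, hF⟩ := hne
      obtain ⟨z, hz⟩ := (hc hF).1.1
      exact ⟨z, F, hF, hz⟩
    · rintro x y ⟨F, hF, hx⟩ ⟨G, hG, hy⟩
      rcases hchain.total hF hG with h | h
      · exact ⟨G, hG, (hc hG).1.2.1 x y (h hx) hy⟩
      · exact ⟨F, hF, (hc hF).1.2.1 x y hx (h hy)⟩
    · rintro x y ⟨F, hF, hx⟩ hxy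
      exact ⟨F, hF, (hc hF).1.2.2 x y hx hxy⟩
    · rintro ⟨F, hF, hx⟩
      exact (hc hF).2 hx) (Set.Ici b) ⟨hI, fun h => hb (le_bot_iff.1 h)⟩
  refine ⟨M, ⟨⟨hM.prop.1, (ne_univ_iff_aux hM.prop.1).2 hM.prop.2⟩, ?_⟩, hbM (le_refl b)⟩
  rintro G ⟨hG, hG'⟩ hMG
  exact Set.Subset.antisymm (hM.le_of_ge ⟨hG, (ne_univ_iff_aux hG).1 hG'⟩ hMG) hMG

theorem dense_aux {L : Type*} [DistribLattice L] [BoundedOrder L] {a b : L}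
    (ha : a ∈ latRad L) (h : b ⊓ a = ⊥) : b = ⊥ := by
  by_contra hb
  obtain ⟨M, hM, hbM⟩ := exists_max_aux hb
  exact (ne_univ_iff_aux hM.1.1).1 hM.1.2 (h ▸ hM.1.1.2.1 b a hbM (ha M hM))

end BddDistLat

open BddDistLat in
theorem stmt_16 {L : Type*} [DistribLattice L] [BoundedOrder L]
    (hco : Conormal L) :
    ∀ x : L,
      (∃ y : L, congMod (latRad L) (x ⊔ y) ⊤ ∧ congMod (latRad L) (x ⊓ y) ⊥) →
      ∃ e : L, (∃ f : L, e ⊔ f = ⊤ ∧ e ⊓ f = ⊥) ∧ congMod (latRad L) e x := by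
  rintro x ⟨y, ⟨a, ha, h1⟩, ⟨a', ha', h2⟩⟩
  have hxy : x ⊓ y = ⊥ := dense_aux ha' (by simpa using h2)
  have hle : a ≤ x ⊔ y := by simpa using h1
  have hR : x ⊔ y ∈ latRad L := fun M hM => hM.1.1.2.2 a _ (ha M hM) hle
  obtain ⟨u, v, huv, hux, hvy⟩ := hco x y hxy
  have huv' : v ⊓ u = ⊥ := by
    apply dense_aux hR
    rw [inf_sup_left, inf_assoc, hux, inf_right_comm, hvy]
    simp
  refine ⟨v, ⟨u, by rw [sup_comm, huv], huv'⟩, x ⊔ y, hR, ?_⟩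
  have hx : v ⊓ x = x := by
    have : (u ⊔ v) ⊓ x = x := by rw [huv, top_inf_eq]
    rwa [inf_sup_right, hux, bot_sup_eq] at this
  rw [inf_sup_left, hvy, hx, inf_sup_self, sup_bot_eq]
end

section
/- Every hyperarchimedean residuated lattice has the Boolean Lifting Property: if for every a ∈ A there exists an integer n ≥ 1 with aⁿ ∈ B(A), then every filter of A has BLP. -/
namespace ResiduatedLattice

theorem rl_mul_le_mul_right {A : Type*} [ResiduatedLattice A] {b c : A} (h : b ≤ c) (d : A) :
    b * d ≤ c * d :=
  (residuation b d (c * d)).1 (h.trans ((residuation c d (c * d)).2 le_rfl))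

theorem rl_le_top_mul {A : Type*} [ResiduatedLattice A] (b d : A) : b * d ≤ d := by
  have h : b ≤ (1 : A) := by rw [one_eq_top]; exact le_top
  simpa using rl_mul_le_mul_right h d

theorem rl_sup_neg_mul {A : Type*} [ResiduatedLattice A] (a : A) :
    (a ⊔ rneg a) * a ≤ a * a := by
  rw [← residuation]
  refine sup_le ((residuation _ _ _).2 le_rfl) ((residuation _ _ _).2 ?_)
  exact ((residuation _ _ _).1 (le_refl (rimp a ⊥))).trans bot_le

theorem rl_imp_pow_mem {A : Type*} [ResiduatedLattice A] {F : Set A} (hF : IsRLFilter F) (a : A)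
    (ha : a ⊔ rneg a ∈ F) (k : ℕ) : rimp a (a ^ (k + 1)) ∈ F := by
  obtain ⟨_, hm, hu⟩ := hF
  induction k with
  | zero =>
    refine hu _ _ ha ((residuation _ _ _).2 ?_)
    simpa using rl_le_top_mul (a ⊔ rneg a) a
  | succ k ih =>
    refine hu _ _ (hm _ _ ih ha) ((residuation _ _ _).2 ?_)
    calc rimp a (a ^ (k + 1)) * (a ⊔ rneg a) * a
        = (a ⊔ rneg a) * a * rimp a (a ^ (k + 1)) := by rw [mul_assoc, mul_comm]
      _ ≤ a * a * rimp a (a ^ (k + 1)) := rl_mul_le_mul_right (rl_sup_neg_mul a) _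
      _ = rimp a (a ^ (k + 1)) * a * a := by rw [mul_comm, mul_assoc]
      _ ≤ a ^ (k + 1) * a :=
        rl_mul_le_mul_right ((residuation _ _ _).1 le_rfl) _
      _ = a ^ (k + 1 + 1) := (pow_succ _ _).symm

end ResiduatedLattice

open ResiduatedLattice in
theorem stmt_18 {A : Type*} [ResiduatedLattice A]
    (hyper : ∀ a : A, ∃ n : ℕ, 1 ≤ n ∧ IsBoolElem (a ^ n)) :
    ∀ F : Set A, IsRLFilter F → HasBLP F := by
  intro F hF a ha
  obtain ⟨n, hn, hb⟩ := hyper a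
  obtain ⟨k, rfl⟩ : ∃ k, n = k + 1 := ⟨n - 1, by omega⟩
  refine ⟨a ^ (k + 1), hb, hF.2.2 _ _ (rl_imp_pow_mem hF a ha k) (le_inf le_rfl ?_)⟩
  rw [residuation, pow_succ, ← mul_assoc]
  exact rl_le_top_mul _ a
end

section
/- A residuated lattice A has the Boolean Lifting Property if and only if the prime spectrum Spec(A), endowed with the Stone topology, is strongly zero-dimensional, i.e., for every closed set T and every open set V of Spec(A) with T ⊆ V there exists a clopen set U of Spec(A) with T ⊆ U ⊆ V. -/
open ResiduatedLattice

/-- The prime spectrum of a residuated lattice. -/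
def RLSpec (A : Type*) [ResiduatedLattice A] : Type _ :=
  {P : Set A // IsPrimeRLFilter P}

/-- The Stone topology on the prime spectrum, generated by the basic open sets
D(a) = {P ∈ Spec(A) | a ∉ P}. -/
instance stoneTopology (A : Type*) [ResiduatedLattice A] :
    TopologicalSpace (RLSpec A) :=
  TopologicalSpace.generateFrom
    {S : Set (RLSpec A) | ∃ a : A, S = {P : RLSpec A | a ∉ P.val}}

namespace RLAux

variable {A : Type*} [ResiduatedLattice A]

theorem mul_mono' {a b : A} (c : A) (h : a ≤ b) : a * c ≤ b * c := by
  rw [← residuation]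
  exact h.trans ((residuation _ _ _).2 le_rfl)

theorem mul_le_l (a b : A) : a * b ≤ a := by
  have h := mul_mono' a (le_top : b ≤ ⊤)
  rw [← one_eq_top, one_mul] at h
  rwa [mul_comm]

theorem mul_le_r (a b : A) : a * b ≤ b := by
  rw [mul_comm]; exact mul_le_l b a

theorem mul_mono2 {a b c d : A} (h : a ≤ b) (k : c ≤ d) : a * c ≤ b * d := by
  refine (mul_mono' c h).trans ?_
  rw [mul_comm b c, mul_comm b d]
  exact mul_mono' b k

theorem sup_mul_le {a b c x : A} (h : a * c ≤ x) (k : b * c ≤ x) : (a ⊔ b) * c ≤ x := by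
  rw [← residuation] at *
  exact sup_le h k

theorem sup_mul_sup (c d b : A) : (c ⊔ b) * (d ⊔ b) ≤ c * d ⊔ b := by
  refine sup_mul_le ?_ ((mul_le_l _ _).trans le_sup_right)
  rw [mul_comm]
  refine sup_mul_le ?_ ((mul_le_l _ _).trans le_sup_right)
  rw [mul_comm]
  exact le_sup_left

theorem mp_le (a b : A) : rimp a b * a ≤ b := (residuation _ _ _).1 le_rfl

theorem mp_mem {F : Set A} (hF : IsRLFilter F) {a b : A} (h : rimp a b ∈ F) (k : a ∈ F) : b ∈ F :=
  hF.2.2 _ _ (hF.2.1 _ _ h k) (mp_le a b)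

theorem quot_filter {P : Set A} (hP : IsRLFilter P) (b : A) : IsRLFilter {c | c ⊔ b ∈ P} := by
  refine ⟨?_, ?_, ?_⟩
  · obtain ⟨p, hp⟩ := hP.1
    exact ⟨p, hP.2.2 _ _ hp le_sup_left⟩
  · intro c d hc hd
    exact hP.2.2 _ _ (hP.2.1 _ _ hc hd) (sup_mul_sup c d b)
  · intro c d hc hd
    exact hP.2.2 _ _ hc (sup_le_sup_right hd b)

theorem exists_prime {F : Set A} (hF : IsRLFilter F) {x : A} (hx : x ∉ F) :
    ∃ P : RLSpec A, F ⊆ P.val ∧ x ∉ P.val := by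
  obtain ⟨P, hFP, hP⟩ := zorn_subset_nonempty {G : Set A | IsRLFilter G ∧ x ∉ G} (by
    intro c hc hch hne
    refine ⟨⋃₀ c, ⟨⟨?_, ?_, ?_⟩, ?_⟩, fun s hs => Set.subset_sUnion_of_mem hs⟩
    · obtain ⟨s, hs⟩ := hne
      obtain ⟨p, hp⟩ := (hc hs).1.1
      exact ⟨p, s, hs, hp⟩
    · rintro a b ⟨s, hs, has⟩ ⟨t, ht, hbt⟩
      rcases hch.total hs ht with h | h
      · exact ⟨t, ht, (hc ht).1.2.1 _ _ (h has) hbt⟩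
      · exact ⟨s, hs, (hc hs).1.2.1 _ _ has (h hbt)⟩
    · rintro a b ⟨s, hs, has⟩ hab
      exact ⟨s, hs, (hc hs).1.2.2 _ _ has hab⟩
    · rintro ⟨s, hs, hxs⟩
      exact (hc hs).2 hxs) F ⟨hF, hx⟩
  have hPf : IsRLFilter P := hP.prop.1
  have hxP : x ∉ P := hP.prop.2
  have key : ∀ b : A, x ⊔ b ∉ P → ∀ a, a ⊔ b ∈ P → a ∈ P := by
    intro b hb a ha
    have hsub : P ⊆ {c | c ⊔ b ∈ P} := fun c hc => hPf.2.2 _ _ hc le_sup_left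
    exact hP.le_of_ge (y := {c | c ⊔ b ∈ P}) ⟨quot_filter hPf b, hb⟩ hsub ha
  refine ⟨⟨P, ⟨hPf, ?_⟩, ?_⟩, hFP, hxP⟩
  · intro h
    exact hxP (h ▸ Set.mem_univ x)
  · intro a b hab
    by_cases h : x ⊔ b ∈ P
    · right
      refine key x (by simpa using hxP) b ?_
      rwa [sup_comm]
    · left
      exact key b h a hab

/-- Intersection of a set of primes. -/
def inter (T : Set (RLSpec A)) : Set A := {a | ∀ P ∈ T, a ∈ P.val}

theorem top_mem {F : Set A} (hF : IsRLFilter F) : (⊤ : A) ∈ F := by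
  obtain ⟨p, hp⟩ := hF.1
  exact hF.2.2 _ _ hp le_top

theorem spec_filter (P : RLSpec A) : IsRLFilter P.val := P.property.1.1

theorem bot_not_mem (P : RLSpec A) : (⊥ : A) ∉ P.val := fun h =>
  P.property.1.2 (Set.eq_univ_of_forall fun a => (spec_filter P).2.2 _ _ h bot_le)

theorem inter_filter (T : Set (RLSpec A)) : IsRLFilter (inter T) :=
  ⟨⟨⊤, fun P _ => top_mem (spec_filter P)⟩,
    fun a b ha hb P hP => (spec_filter P).2.1 _ _ (ha P hP) (hb P hP),
    fun a b ha hab P hP => (spec_filter P).2.2 _ _ (ha P hP) hab⟩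

theorem isOpen_D (a : A) : IsOpen {P : RLSpec A | a ∉ P.val} :=
  TopologicalSpace.isOpen_generateFrom_of_mem ⟨a, rfl⟩

theorem isClosed_V (a : A) : IsClosed {P : RLSpec A | a ∈ P.val} := by
  rw [← isOpen_compl_iff]
  exact isOpen_D a

theorem open_basis {V : Set (RLSpec A)} (hV : IsOpen V) :
    ∀ P ∈ V, ∃ a : A, a ∉ P.val ∧ ∀ Q : RLSpec A, a ∉ Q.val → Q ∈ V := by
  have hV' : TopologicalSpace.GenerateOpen
    {S : Set (RLSpec A) | ∃ a : A, S = {P : RLSpec A | a ∉ P.val}} V := hV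
  induction hV' with
  | basic s hs =>
    obtain ⟨a, rfl⟩ := hs
    exact fun P hP => ⟨a, hP, fun Q hQ => hQ⟩
  | univ => exact fun P _ => ⟨⊥, bot_not_mem P, fun Q _ => trivial⟩
  | inter s t hs ht ihs iht =>
    rintro P ⟨h1, h2⟩
    obtain ⟨a, ha, ha'⟩ := ihs hs P h1
    obtain ⟨b, hb, hb'⟩ := iht ht P h2
    refine ⟨a ⊔ b, fun h => (P.property.2 a b h).elim ha hb, fun Q hQ => ⟨ha' Q fun h => hQ ?_, hb' Q fun h => hQ ?_⟩⟩
    · exact (spec_filter Q).2.2 _ _ h le_sup_left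
    · exact (spec_filter Q).2.2 _ _ h le_sup_right
  | sUnion S hS ih =>
    rintro P ⟨s, hs, hP⟩
    obtain ⟨a, ha, ha'⟩ := ih s hs (hS s hs) P hP
    exact ⟨a, ha, fun Q hQ => ⟨s, hs, ha' Q hQ⟩⟩

theorem mem_closed {T : Set (RLSpec A)} (hT : IsClosed T) (P : RLSpec A)
    (h : inter T ⊆ P.val) : P ∈ T := by
  by_contra hP
  obtain ⟨a, ha, ha'⟩ := open_basis hT.isOpen_compl P hP
  refine ha (h fun Q hQ => ?_)
  by_contra hQa
  exact ha' Q hQa hQ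

theorem disjoint_closed {T S : Set (RLSpec A)} (hT : IsClosed T) (hS : IsClosed S)
    (h : ∀ P ∈ T, P ∉ S) : ∃ f ∈ inter T, ∃ g ∈ inter S, f * g ≤ ⊥ := by
  by_contra hcon
  have hF := inter_filter T
  have hG := inter_filter S
  have hK : IsRLFilter {c : A | ∃ f ∈ inter T, ∃ g ∈ inter S, f * g ≤ c} := by
    refine ⟨⟨⊤, ⊤, top_mem hF, ⊤, top_mem hG, le_top⟩, ?_, ?_⟩
    · rintro a b ⟨f, hf, g, hg, hfg⟩ ⟨f', hf', g', hg', hfg'⟩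
      refine ⟨f * f', hF.2.1 _ _ hf hf', g * g', hG.2.1 _ _ hg hg', ?_⟩
      rw [mul_mul_mul_comm]
      exact mul_mono2 hfg hfg'
    · rintro a b ⟨f, hf, g, hg, hfg⟩ hab
      exact ⟨f, hf, g, hg, hfg.trans hab⟩
  obtain ⟨P, hP, -⟩ := exists_prime hK hcon
  refine h P (mem_closed hT P fun f hf => hP ⟨f, hf, ⊤, top_mem hG, mul_le_l _ _⟩)
    (mem_closed hS P fun g hg => hP ⟨⊤, top_mem hF, g, hg, mul_le_r _ _⟩)

theorem mem_of_primes {F : Set A} (hF : IsRLFilter F) {x : A}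
    (h : ∀ P : RLSpec A, F ⊆ P.val → x ∈ P.val) : x ∈ F := by
  by_contra hx
  obtain ⟨P, h1, h2⟩ := exists_prime hF hx
  exact h2 (h P h1)

theorem triv_filter : IsRLFilter ({⊤} : Set A) := by
  refine ⟨⟨⊤, rfl⟩, ?_, ?_⟩
  · rintro a b rfl rfl
    rw [← one_eq_top, one_mul]; rfl
  · rintro a b rfl h
    exact top_le_iff.1 h

theorem clopen_bool {U : Set (RLSpec A)} (hU : IsClopen U) :
    ∃ e f : A, e ⊔ f = ⊤ ∧ e ⊓ f = ⊥ ∧ (∀ P ∈ U, e ∈ P.val) ∧ (∀ P ∉ U, f ∈ P.val) := by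
  obtain ⟨e, he, f, hf, hef⟩ := disjoint_closed hU.1 hU.2.isClosed_compl
    (fun P hP hP' => hP' hP)
  have h1 : e ⊔ f = ⊤ := by
    refine mem_of_primes triv_filter fun P _ => ?_
    by_cases hP : P ∈ U
    · exact (spec_filter P).2.2 _ _ (he P hP) le_sup_left
    · exact (spec_filter P).2.2 _ _ (hf P hP) le_sup_right
  refine ⟨e, f, h1, ?_, he, hf⟩
  refine le_bot_iff.1 ?_
  have : (e ⊔ f) * (e ⊓ f) ≤ ⊥ := by
    refine sup_mul_le ?_ ?_
    · exact (mul_mono2 le_rfl inf_le_right).trans hef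
    · refine (mul_mono2 le_rfl inf_le_left).trans ?_
      rwa [mul_comm]
  rwa [h1, ← one_eq_top, one_mul] at this

theorem mul_bot_of_compl {e f : A} (h : e ⊓ f = ⊥) : e * f ≤ ⊥ :=
  h ▸ le_inf (mul_le_l _ _) (mul_le_r _ _)

theorem not_both (P : RLSpec A) {e f : A} (h : e * f ≤ ⊥) (he : e ∈ P.val) (hf : f ∈ P.val) :
    False :=
  bot_not_mem P ((spec_filter P).2.2 _ _ ((spec_filter P).2.1 _ _ he hf) h)

theorem bool_clopen {e : A} (he : IsBoolElem e) : IsClopen {P : RLSpec A | e ∈ P.val} := by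
  obtain ⟨f, h1, h2⟩ := he
  refine ⟨isClosed_V e, ?_⟩
  have : {P : RLSpec A | e ∈ P.val} = {P : RLSpec A | f ∉ P.val} := by
    ext P
    refine ⟨fun h h' => not_both P (mul_bot_of_compl h2) h h', fun h => ?_⟩
    exact (P.property.2 e f (h1 ▸ top_mem (spec_filter P))).resolve_right h
  rw [this]
  exact isOpen_D f

theorem inf_mem {F : Set A} (hF : IsRLFilter F) {a b : A} (ha : a ∈ F) (hb : b ∈ F) : a ⊓ b ∈ F :=
  hF.2.2 _ _ (hF.2.1 _ _ ha hb) (le_inf (mul_le_l _ _) (mul_le_r _ _))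

end RLAux

theorem stmt_19 {A : Type*} [ResiduatedLattice A] :
    (∀ F : Set A, IsRLFilter F → HasBLP F) ↔
      (∀ T V : Set (RLSpec A), IsClosed T → IsOpen V → T ⊆ V →
        ∃ U : Set (RLSpec A), IsClopen U ∧ T ⊆ U ∧ U ⊆ V) := by
  constructor
  · intro hBLP T V hT hV hTV
    obtain ⟨f, hf, g, hg, hfg⟩ := RLAux.disjoint_closed hT hV.isClosed_compl
      (fun P hP hP' => hP' (hTV hP))
    have hng : g ≤ rneg f := (residuation _ _ _).2 (by rwa [mul_comm])
    obtain ⟨e, he, hd⟩ := hBLP _ (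
      RLAux.inter_filter (T ∪ Vᶜ)) f (by
        rintro P (hP | hP)
        · exact (RLAux.spec_filter P).2.2 _ _ (hf P hP) le_sup_left
        · exact (RLAux.spec_filter P).2.2 _ _ (hg P hP) (hng.trans le_sup_right))
    refine ⟨_, RLAux.bool_clopen he, fun P hP => ?_, fun P hP => ?_⟩
    · have h := (RLAux.spec_filter P).2.2 _ _ (hd P (Or.inl hP)) inf_le_left
      exact RLAux.mp_mem (RLAux.spec_filter P) h (hf P hP)
    · by_contra hPV
      have h := (RLAux.spec_filter P).2.2 _ _ (hd P (Or.inr hPV)) inf_le_right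
      exact RLAux.not_both P hfg (RLAux.mp_mem (RLAux.spec_filter P) h hP) (hg P hPV)
  · intro hZ F hF a ha
    have hT : IsClosed {P : RLSpec A | F ⊆ P.val ∧ a ∈ P.val} := by
      have : {P : RLSpec A | F ⊆ P.val ∧ a ∈ P.val} =
          (⋂ x ∈ F, {P : RLSpec A | x ∈ P.val}) ∩ {P : RLSpec A | a ∈ P.val} := by
        ext P
        simp [Set.subset_def]
      rw [this]
      exact (isClosed_biInter fun x _ => RLAux.isClosed_V x).inter (RLAux.isClosed_V a)
    obtain ⟨U, hU, hTU, hUV⟩ := hZ _ _ hT (RLAux.isOpen_D (rneg a))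
      (fun P hP h => RLAux.not_both P (RLAux.mp_le a ⊥) h hP.2)
    obtain ⟨e, f, h1, h2, he, hf⟩ := RLAux.clopen_bool hU
    refine ⟨e, ⟨f, h1, h2⟩, RLAux.mem_of_primes hF fun P hP => ?_⟩
    have hPf := RLAux.spec_filter P
    have hor := P.property.2 _ _ (hP ha)
    by_cases hPU : P ∈ U
    · have haP : a ∈ P.val := hor.resolve_right (hUV hPU)
      exact RLAux.inf_mem hPf
        (hPf.2.2 _ _ (he P hPU) ((residuation _ _ _).2 (RLAux.mul_le_l _ _)))
        (hPf.2.2 _ _ haP ((residuation _ _ _).2 (RLAux.mul_le_l _ _)))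
    · have haP : rneg a ∈ P.val := hor.resolve_left fun h => hPU (hTU ⟨hP, h⟩)
      refine RLAux.inf_mem hPf
        (hPf.2.2 _ _ haP ((residuation _ _ _).2 ((RLAux.mp_le a ⊥).trans bot_le)))
        (hPf.2.2 _ _ (hf P hPU) ((residuation _ _ _).2 ?_))
      rw [mul_comm]
      exact (RLAux.mul_bot_of_compl h2).trans bot_le
end
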